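/- For every integer n ≥ 9, the direct product Part(n) × Part(n+1) × … × Part(3n−14) of partition lattices is a four-generated lattice. -/

import Mathlib

/-- A lattice is *four-generated* if it has a four-element subset `X` such that the
smallest sublattice containing `X` (the closure of `X` under binary meets and joins)
is the whole lattice. -/
def FourGenerated (L : Type*) [Lattice L] : Prop :=
  ∃ X : Finset L, X.card = 4 ∧ latticeClosure (X : Set L) = Set.univ

/-- The two-block partition of `{0, …, m - 1}` by parity. -/
def parity (m : ℕ) : Setoid (Fin m) := Setoid.ker fun x => x.val % 2

/-- The partition of the path `0, …, m - 1` whose nontrivial blocks are every other edge: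
`{2i, 2i + 1}` for `ε = 0`, and `{2i - 1, 2i}` for `ε = 1`. -/
def edges (m ε : ℕ) : Setoid (Fin m) := Setoid.ker fun x => (x.val + ε) / 2

/-- Congruence modulo `d` restricted to the interval `[lo, hi]`. -/
def congrOn (m d lo hi : ℕ) : Setoid (Fin m) where
  r x y := x.val = y.val ∨
    (x.val % d = y.val % d ∧ lo ≤ x.val ∧ x.val ≤ hi ∧ lo ≤ y.val ∧ y.val ≤ hi)
  iseqv := ⟨fun _ => Or.inl rfl, fun h => by omega, by
    rintro x y z (h₁ | h₁) (h₂ | h₂)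
    · exact Or.inl (h₁.trans h₂)
    · exact Or.inr (by rwa [h₁])
    · exact Or.inr (by rwa [← h₂])
    · exact Or.inr (by omega)⟩

/-- The partition with at most one nontrivial block `{i, j, k}`. -/
def triple (m i j k : ℕ) : Setoid (Fin m) where
  r x y := x.val = y.val ∨
    ((x.val = i ∨ x.val = j ∨ x.val = k) ∧ (y.val = i ∨ y.val = j ∨ y.val = k))
  iseqv := ⟨fun _ => Or.inl rfl, fun h => by omega, fun h₁ h₂ => by omega⟩

/-- The partition with at most one nontrivial block `{i, j}`. -/
def pair (m i j : ℕ) : Setoid (Fin m) where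
  r x y := x.val = y.val ∨ (x.val = i ∧ y.val = j) ∨ (x.val = j ∧ y.val = i)
  iseqv := ⟨fun _ => Or.inl rfl, fun h => by omega, fun h₁ h₂ => by omega⟩

/-- A map whose kernel is generated by the pairs `{0, 1}`, `{c, c + 1}` and `{s, s + 4}`. -/
def markFun (c s x : ℕ) : ℕ :=
  if x = 1 then 0
  else if x = c + 1 then (if s + 4 = c then s else c)
  else if x = s + 4 then (if s = 1 then 0 else s)
  else x

/-- The partition generated by the pairs `{0, 1}`, `{c, c + 1}` and `{s, s + 4}`. -/
def marks (m c s : ℕ) : Setoid (Fin m) := Setoid.ker fun x => markFun c s x.val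

section Order

variable {m : ℕ} {x y : Fin m}

theorem parity_iff : parity m x y ↔ x.val % 2 = y.val % 2 := Iff.rfl

theorem edges_iff {ε : ℕ} : edges m ε x y ↔ (x.val + ε) / 2 = (y.val + ε) / 2 := Iff.rfl

theorem congrOn_iff {d lo hi : ℕ} : congrOn m d lo hi x y ↔ x.val = y.val ∨
    (x.val % d = y.val % d ∧ lo ≤ x.val ∧ x.val ≤ hi ∧ lo ≤ y.val ∧ y.val ≤ hi) := Iff.rfl

theorem triple_iff {i j k : ℕ} : triple m i j k x y ↔ x.val = y.val ∨
    ((x.val = i ∨ x.val = j ∨ x.val = k) ∧ (y.val = i ∨ y.val = j ∨ y.val = k)) := Iff.rfl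

theorem pair_iff {i j : ℕ} : pair m i j x y ↔
    x.val = y.val ∨ (x.val = i ∧ y.val = j) ∨ (x.val = j ∧ y.val = i) := Iff.rfl

theorem marks_iff {c s : ℕ} : marks m c s x y ↔ markFun c s x.val = markFun c s y.val := Iff.rfl

theorem pair_le {i j : ℕ} {θ : Setoid (Fin m)}
    (h : ∀ (hi : i < m) (hj : j < m), θ ⟨i, hi⟩ ⟨j, hj⟩) : pair m i j ≤ θ := by
  rintro ⟨x, hx⟩ ⟨y, hy⟩ (hxy | ⟨rfl, rfl⟩ | ⟨rfl, rfl⟩)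
  · obtain rfl : x = y := hxy
    exact θ.refl _
  · exact h hx hy
  · exact θ.symm (h hy hx)

theorem setoid_le_bot {α : Type*} {θ : Setoid α} (h : ∀ x y, θ x y → x = y) : θ ≤ ⊥ :=
  fun {x y} hxy => h x y hxy

theorem sup_inl {α : Type*} {θ ψ : Setoid α} {x y : α} (h : θ x y) : (θ ⊔ ψ) x y :=
  (le_sup_left : θ ≤ θ ⊔ ψ) h

theorem sup_inr {α : Type*} {θ ψ : Setoid α} {x y : α} (h : ψ x y) : (θ ⊔ ψ) x y :=
  (le_sup_right : ψ ≤ θ ⊔ ψ) h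

/-- Two points related through the images, under a second relation, of two related points are
related by the join. -/
theorem sup_conj {α : Type*} {θ ψ : Setoid α} {x y u v : α} (hx : ψ x u) (h : θ u v)
    (hy : ψ y v) : (θ ⊔ ψ) x y :=
  (θ ⊔ ψ).trans (sup_inr hx) ((θ ⊔ ψ).trans (sup_inl h) ((θ ⊔ ψ).symm (sup_inr hy)))

theorem congrOn_succ_le {d lo hi : ℕ} (hd : 0 < d) (h : lo + d ≤ hi + 1) :
    congrOn m d lo (hi + 1) ≤ congrOn m d lo hi ⊔ pair m (hi + 1 - d) (hi + 1) := by
  have key : ∀ x y : Fin m, congrOn m d lo (hi + 1) x y → y.val = hi + 1 → x.val ≤ hi →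
      (congrOn m d lo hi ⊔ pair m (hi + 1 - d) (hi + 1)) x y := by
    intro x y hxy hy hx
    rw [congrOn_iff] at hxy
    have hlt : hi + 1 - d < m := by omega
    refine Setoid.trans' _ (y := ⟨hi + 1 - d, hlt⟩) (sup_inl ?_) (sup_inr ?_)
    · refine congrOn_iff.2 (Or.inr ⟨?_, by omega, by omega, by simp; omega, by simp; omega⟩)
      have : x.val % d = y.val % d := by omega
      rw [this, hy]
      exact Nat.mod_eq_sub_mod (by omega)
    · exact pair_iff.2 (Or.inr (Or.inl ⟨rfl, hy⟩))
  intro x y hxy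
  have hxy' := congrOn_iff.1 hxy
  by_cases hx : x.val = hi + 1
  · by_cases hy : y.val = hi + 1
    · exact sup_inl (congrOn_iff.2 (Or.inl (by omega)))
    · exact Setoid.symm' _ (key y x (Setoid.symm' _ hxy) hx (by omega))
  · by_cases hy : y.val = hi + 1
    · exact key x y hxy hy (by omega)
    · exact sup_inl (congrOn_iff.2 (by omega))

theorem congrOn_two_le_succ {lo hi : ℕ} (h : lo + 2 ≤ hi) :
    congrOn m 2 lo hi ≤ congrOn m 2 (lo + 1) hi ⊔ pair m lo (lo + 2) := by
  have key : ∀ x y : Fin m, congrOn m 2 lo hi x y → y.val = lo → lo < x.val →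
      (congrOn m 2 (lo + 1) hi ⊔ pair m lo (lo + 2)) x y := by
    intro x y hxy hy hx
    rw [congrOn_iff] at hxy
    have hlt : lo + 2 < m := by omega
    refine Setoid.trans' _ (y := ⟨lo + 2, hlt⟩) (sup_inl ?_) (sup_inr ?_)
    · exact congrOn_iff.2 (by dsimp only; omega)
    · exact pair_iff.2 (by dsimp only; omega)
  intro x y hxy
  have hxy' := congrOn_iff.1 hxy
  by_cases hx : x.val = lo
  · by_cases hy : y.val = lo
    · exact sup_inl (congrOn_iff.2 (Or.inl (by omega)))
    · exact Setoid.symm' _ (key y x (Setoid.symm' _ hxy) hx (by omega))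
  · by_cases hy : y.val = lo
    · exact key x y hxy hy (by omega)
    · exact sup_inl (congrOn_iff.2 (by omega))

theorem parity_inf_edges (m ε : ℕ) : parity m ⊓ edges m ε = ⊥ := by
  refine le_bot_iff.1 (setoid_le_bot fun x y ⟨h₁, h₂⟩ => Fin.ext ?_)
  have h₁ := parity_iff.1 h₁
  have h₂ := edges_iff.1 h₂
  omega

theorem edges_inf_edges (m : ℕ) : edges m 0 ⊓ edges m 1 = ⊥ := by
  refine le_bot_iff.1 (setoid_le_bot fun x y ⟨h₁, h₂⟩ => Fin.ext ?_)
  have h₁ := edges_iff.1 h₁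
  have h₂ := edges_iff.1 h₂
  omega

theorem parity_sup_edges_one (hm : 3 ≤ m) : parity m ⊔ edges m 1 = ⊤ := by
  have key : ∀ x : Fin m, (parity m ⊔ edges m 1) x ⟨1, by omega⟩ := by
    intro x
    by_cases hx : x.val % 2 = 1
    · exact sup_inl (parity_iff.2 (by simpa using hx))
    · exact Setoid.trans' _ (y := ⟨2, by omega⟩)
        (sup_inl (parity_iff.2 (by simpa using hx))) (sup_inr (edges_iff.2 (by simp)))
  exact top_le_iff.1 fun {x y} _ => Setoid.trans' _ (key x) (Setoid.symm' _ (key y))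

theorem parity_sup_edges_zero (hm : 2 ≤ m) : parity m ⊔ edges m 0 = ⊤ := by
  have key : ∀ x : Fin m, (parity m ⊔ edges m 0) x ⟨1, by omega⟩ := by
    intro x
    by_cases hx : x.val % 2 = 1
    · exact sup_inl (parity_iff.2 (by simpa using hx))
    · exact Setoid.trans' _ (y := ⟨0, by omega⟩)
        (sup_inl (parity_iff.2 (by simpa using hx))) (sup_inr (edges_iff.2 (by simp)))
  exact top_le_iff.1 fun {x y} _ => Setoid.trans' _ (key x) (Setoid.symm' _ (key y))

theorem edges_zero_inf_marks_le {c s : ℕ} (hc : 7 ≤ c) (hco : c % 2 = 1) (hs : s + 4 ≤ c) :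
    edges m 0 ⊓ marks m c s ≤ pair m 0 1 := by
  rintro x y ⟨h₁, h₂⟩
  have h₁ := edges_iff.1 h₁
  have h₂ := marks_iff.1 h₂
  refine pair_iff.2 ?_
  unfold markFun at h₂
  split_ifs at h₂ <;> omega

theorem edges_one_inf_marks_le {c s : ℕ} (hc : 7 ≤ c) (hco : c % 2 = 1) (hs : s + 4 ≤ c) :
    edges m 1 ⊓ marks m c s ≤ pair m c (c + 1) := by
  rintro x y ⟨h₁, h₂⟩
  have h₁ := edges_iff.1 h₁
  have h₂ := marks_iff.1 h₂
  refine pair_iff.2 ?_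
  unfold markFun at h₂
  split_ifs at h₂ <;> omega

theorem parity_inf_marks_le {c s : ℕ} (hco : c % 2 = 1) (hs : s + 4 ≤ c) :
    parity m ⊓ marks m c s ≤ pair m s (s + 4) := by
  rintro x y ⟨h₁, h₂⟩
  have h₁ := parity_iff.1 h₁
  have h₂ := marks_iff.1 h₂
  refine pair_iff.2 ?_
  unfold markFun at h₂
  split_ifs at h₂ <;> omega

theorem pair_zero_one_le {c s : ℕ} : pair m 0 1 ≤ edges m 0 ⊓ marks m c s := by
  refine pair_le fun _ _ => ⟨edges_iff.2 (by simp), marks_iff.2 ?_⟩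
  simp only [markFun]
  split_ifs <;> omega

theorem pair_last_le {c s : ℕ} (hc : 7 ≤ c) (hco : c % 2 = 1) :
    pair m c (c + 1) ≤ edges m 1 ⊓ marks m c s := by
  refine pair_le fun _ _ => ⟨edges_iff.2 (by dsimp only; omega), marks_iff.2 ?_⟩
  simp only [markFun]
  split_ifs <;> omega

theorem pair_mark_le {c s : ℕ} (hs : s + 4 ≤ c) :
    pair m s (s + 4) ≤ parity m ⊓ marks m c s := by
  refine pair_le fun _ _ => ⟨parity_iff.2 (by dsimp only; omega), marks_iff.2 ?_⟩
  simp only [markFun]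
  split_ifs <;> omega

/-- Moving a pair of points of the same parity one step along the path. -/
theorem pair_succ_le {x d : ℕ} (hd : d % 2 = 0) :
    pair m (x + 1) (x + 1 + d) ≤ (pair m x (x + d) ⊔ edges m (x % 2)) ⊓ parity m := by
  refine pair_le fun _ _ => ⟨?_, parity_iff.2 (by dsimp only; omega)⟩
  exact sup_conj (u := ⟨x, by omega⟩) (v := ⟨x + d, by omega⟩)
    (edges_iff.2 (by dsimp only; omega)) (pair_iff.2 (by simp))
    (edges_iff.2 (by dsimp only; omega))

theorem pair_le_succ {x d : ℕ} (hd : d % 2 = 0) (h : x + 1 + d < m) :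
    pair m x (x + d) ≤ (pair m (x + 1) (x + 1 + d) ⊔ edges m (x % 2)) ⊓ parity m := by
  refine pair_le fun _ _ => ⟨?_, parity_iff.2 (by dsimp only; omega)⟩
  exact sup_conj (u := ⟨x + 1, by omega⟩) (v := ⟨x + 1 + d, by omega⟩)
    (edges_iff.2 (by dsimp only; omega)) (pair_iff.2 (by simp))
    (edges_iff.2 (by dsimp only; omega))

theorem congrOn_zero_succ_le {k : ℕ} (hk : 2 ≤ k) : congrOn m 2 0 (k + 1) ≤
    congrOn m 2 0 k ⊔ ((congrOn m 2 0 k ⊔ edges m (k % 2)) ⊓ parity m) := by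
  refine (congrOn_succ_le two_pos (by omega)).trans (sup_le_sup_left ?_ _)
  refine pair_le fun _ _ => ⟨?_, parity_iff.2 (by dsimp only; omega)⟩
  exact sup_conj (u := ⟨k - 2, by omega⟩) (v := ⟨k, by omega⟩)
    (edges_iff.2 (by dsimp only; omega)) (congrOn_iff.2 (by dsimp only; omega))
    (edges_iff.2 (by dsimp only; omega))

theorem le_congrOn_zero_succ {k : ℕ} :
    congrOn m 2 0 k ⊔ ((congrOn m 2 0 k ⊔ edges m (k % 2)) ⊓ parity m) ≤
      congrOn m 2 0 (k + 1) := by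
  refine sup_le (fun {x y} h => congrOn_iff.2 (by have := congrOn_iff.1 h; omega)) ?_
  have h : congrOn m 2 0 k ⊔ edges m (k % 2) ≤
      Setoid.ker fun x : Fin m => if x.val ≤ k + 1 then 0 else (x.val + k % 2) / 2 := by
    refine sup_le (fun {x y} h => ?_) (fun {x y} h => ?_)
    · have := congrOn_iff.1 h
      rw [Setoid.ker_def]
      split_ifs <;> omega
    · have := edges_iff.1 h
      rw [Setoid.ker_def]
      split_ifs <;> omega
  rintro x y ⟨h₁, h₂⟩
  have h₁ := Setoid.ker_def.1 (h h₁)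
  have h₂ := parity_iff.1 h₂
  refine congrOn_iff.2 ?_
  split_ifs at h₁ <;> omega

theorem congrOn_le_congrOn_succ {lo hi : ℕ} (h : lo + 3 ≤ hi) (hm : hi < m) :
    congrOn m 2 lo hi ≤ congrOn m 2 (lo + 1) hi ⊔
      ((congrOn m 2 (lo + 1) hi ⊔ edges m (lo % 2)) ⊓ parity m) := by
  refine (congrOn_two_le_succ (by omega)).trans (sup_le_sup_left ?_ _)
  refine pair_le fun _ _ => ⟨?_, parity_iff.2 (by dsimp only; omega)⟩
  exact sup_conj (u := ⟨lo + 1, by omega⟩) (v := ⟨lo + 3, by omega⟩)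
    (edges_iff.2 (by dsimp only; omega)) (congrOn_iff.2 (by dsimp only; omega))
    (edges_iff.2 (by dsimp only; omega))

theorem congrOn_succ_le_congrOn {lo : ℕ} :
    congrOn m 2 (lo + 1) m ⊔ ((congrOn m 2 (lo + 1) m ⊔ edges m (lo % 2)) ⊓ parity m) ≤
      congrOn m 2 lo m := by
  refine sup_le (fun {x y} h => congrOn_iff.2 (by have := congrOn_iff.1 h; omega)) ?_
  have h : congrOn m 2 (lo + 1) m ⊔ edges m (lo % 2) ≤
      Setoid.ker fun x : Fin m => if lo ≤ x.val then m else (x.val + lo % 2) / 2 := by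
    refine sup_le (fun {x y} h => ?_) (fun {x y} h => ?_)
    · have := congrOn_iff.1 h
      rw [Setoid.ker_def]
      split_ifs <;> omega
    · have := edges_iff.1 h
      rw [Setoid.ker_def]
      split_ifs <;> omega
  rintro x y ⟨h₁, h₂⟩
  have h₁ := Setoid.ker_def.1 (h h₁)
  have h₂ := parity_iff.1 h₂
  have := x.isLt
  have := y.isLt
  refine congrOn_iff.2 ?_
  split_ifs at h₁ <;> omega

end Order

/-- A relation between two lattices that is compatible with joins and meets, decreasing in its
first argument and increasing in its second one. The example to keep in mind: some element of
a sublattice of a product is above `x` in one coordinate and below `y` in another one. -/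
structure Approx {L K : Type*} [Lattice L] [Lattice K] (P : L → K → Prop) : Prop where
  sup : ∀ {x y x' y'}, P x y → P x' y' → P (x ⊔ x') (y ⊔ y')
  inf : ∀ {x y x' y'}, P x y → P x' y' → P (x ⊓ x') (y ⊓ y')
  mono : ∀ {x y x' y'}, P x y → x' ≤ x → y ≤ y' → P x' y'

/-- The second coordinates of the parity partition and of the two edge partitions are pairwise
disjoint. -/
structure DisjointRoles {K : Type*} [Lattice K] [OrderBot K] (m : ℕ)
    (P : Setoid (Fin m) → K → Prop) (a b₀ b₁ : K) : Prop extends Approx P where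
  parity : P (parity m) a
  edges₀ : P (edges m 0) b₀
  edges₁ : P (edges m 1) b₁
  disj₀ : a ⊓ b₀ = ⊥
  disj₁ : a ⊓ b₁ = ⊥
  disj : b₀ ⊓ b₁ = ⊥

namespace DisjointRoles

variable {K : Type*} [Lattice K] [OrderBot K] {m : ℕ} {P : Setoid (Fin m) → K → Prop}
  {a b₀ b₁ : K}

theorem bot (h : DisjointRoles m P a b₀ b₁) : P ⊥ ⊥ :=
  h.mono (h.inf h.parity h.edges₀) bot_le h.disj₀.le

theorem step (h : DisjointRoles m P a b₀ b₁) {x : Setoid (Fin m)} (hx : P x ⊥) (k : ℕ) :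
    P ((x ⊔ edges m (k % 2)) ⊓ _root_.parity m) ⊥ := by
  rcases Nat.mod_two_eq_zero_or_one k with hk | hk <;> rw [hk]
  · exact h.mono (h.inf (h.sup hx h.edges₀) h.parity) le_rfl
      (by rw [bot_sup_eq, inf_comm, h.disj₀])
  · exact h.mono (h.inf (h.sup hx h.edges₁) h.parity) le_rfl
      (by rw [bot_sup_eq, inf_comm, h.disj₁])

theorem pair_shift (h : DisjointRoles m P a b₀ b₁) {x d : ℕ} (hd : d % 2 = 0) (hx : x + d < m)
    (hP : P (pair m x (x + d)) ⊥) (y : ℕ) : P (pair m y (y + d)) ⊥ := by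
  have up : ∀ y, P (pair m y (y + d)) ⊥ → P (pair m (y + 1) (y + 1 + d)) ⊥ := fun y hy =>
    h.mono (h.step hy y) (pair_succ_le hd) le_rfl
  have down : ∀ y, y ≤ x → P (pair m (x - y) (x - y + d)) ⊥ := by
    intro y
    induction y with
    | zero => intro _; exact hP
    | succ y ih =>
      intro hy
      have hP' := ih (by omega)
      rw [show x - y = x - (y + 1) + 1 by omega] at hP'
      exact h.mono (h.step hP' (x - (y + 1))) (pair_le_succ hd (by omega)) le_rfl
  induction y with
  | zero => simpa using down x le_rfl
  | succ y ih => exact up y ih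

theorem congrOn_bot (h : DisjointRoles m P a b₀ b₁) {x d : ℕ} (hd0 : 0 < d) (hd : d % 2 = 0)
    (hx : x + d < m) (hP : P (pair m x (x + d)) ⊥) (k : ℕ) : P (congrOn m d 0 k) ⊥ := by
  induction k with
  | zero =>
    refine h.mono h.bot (setoid_le_bot fun x y hxy => Fin.ext ?_) le_rfl
    have := congrOn_iff.1 hxy
    omega
  | succ k ih =>
    by_cases hk : d ≤ k + 1
    · refine h.mono (h.sup ih (h.pair_shift hd hx hP (k + 1 - d)))
        ((congrOn_succ_le hd0 (by omega)).trans ?_) (by simp)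
      rw [Nat.sub_add_cancel hk]
    · refine h.mono h.bot (setoid_le_bot fun x y hxy => Fin.ext ?_) le_rfl
      rcases congrOn_iff.1 hxy with h | ⟨h, -, h₁, -, h₂⟩
      · exact h
      · rwa [Nat.mod_eq_of_lt (by omega), Nat.mod_eq_of_lt (by omega)] at h

theorem top_bot (h : DisjointRoles m P a b₀ b₁) {x : ℕ} (hx : x + 2 < m)
    (hP : P (pair m x (x + 2)) ⊥) : P ⊤ ⊥ := by
  have hα : P (_root_.parity m) ⊥ := by
    refine h.mono (h.congrOn_bot two_pos rfl hx hP m) (fun {x y} hxy => ?_) le_rfl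
    have := parity_iff.1 hxy
    exact congrOn_iff.2 (by omega)
  have hβ : P (edges m 0) ⊥ := by
    refine h.mono (h.inf (h.sup hα h.edges₁) h.edges₀) ?_ ?_
    · rw [parity_sup_edges_one (by omega), top_inf_eq]
    · rw [bot_sup_eq, inf_comm, h.disj]
  exact h.mono (h.sup hα hβ) (parity_sup_edges_zero (by omega)).ge (by simp)

end DisjointRoles

/-- Corresponding generators of two partition lattices are related. -/
structure SameRoles (m c s m' c' s' : ℕ) (P : Setoid (Fin m) → Setoid (Fin m') → Prop) : Prop
    extends Approx P where
  parity : P (parity m) (parity m')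
  edges₀ : P (edges m 0) (edges m' 0)
  edges₁ : P (edges m 1) (edges m' 1)
  marks : P (marks m c s) (marks m' c' s')
  seven_le : 7 ≤ c
  odd : c % 2 = 1
  lt_size : c + 1 < m
  mark_le : s + 4 ≤ c
  seven_le' : 7 ≤ c'
  odd' : c' % 2 = 1
  lt_size' : c' + 1 < m'
  mark_le' : s' + 4 ≤ c'

namespace SameRoles

variable {m c s m' c' s' : ℕ} {P : Setoid (Fin m) → Setoid (Fin m') → Prop}

theorem disjointRoles (h : SameRoles m c s m' c' s' P) :
    DisjointRoles m P (_root_.parity m') (_root_.edges m' 0) (_root_.edges m' 1) where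
  toApprox := h.toApprox
  parity := h.parity
  edges₀ := h.edges₀
  edges₁ := h.edges₁
  disj₀ := parity_inf_edges m' 0
  disj₁ := parity_inf_edges m' 1
  disj := edges_inf_edges m'

theorem edges (h : SameRoles m c s m' c' s' P) (k : ℕ) :
    P (edges m (k % 2)) (_root_.edges m' (k % 2)) := by
  rcases Nat.mod_two_eq_zero_or_one k with hk | hk <;> rw [hk]
  exacts [h.edges₀, h.edges₁]

theorem pair_zero_one (h : SameRoles m c s m' c' s' P) : P (pair m 0 1) (pair m' 0 1) :=
  h.mono (h.inf h.edges₀ h.marks) pair_zero_one_le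
    (edges_zero_inf_marks_le h.seven_le' h.odd' h.mark_le')

theorem pair_last (h : SameRoles m c s m' c' s' P) :
    P (pair m c (c + 1)) (pair m' c' (c' + 1)) :=
  h.mono (h.inf h.edges₁ h.marks) (pair_last_le h.seven_le h.odd)
    (edges_one_inf_marks_le h.seven_le' h.odd' h.mark_le')

theorem pair_mark (h : SameRoles m c s m' c' s' P) :
    P (pair m s (s + 4)) (pair m' s' (s' + 4)) :=
  h.mono (h.inf h.parity h.marks) (pair_mark_le h.mark_le)
    (parity_inf_marks_le h.odd' h.mark_le')

theorem initial (h : SameRoles m c s m' c' s' P) {k : ℕ} (hk : 2 ≤ k) :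
    P (congrOn m 2 0 k) (congrOn m' 2 0 k) := by
  induction k, hk using Nat.le_induction with
  | base =>
    refine h.mono (h.inf (h.sup h.pair_zero_one h.edges₁) h.parity) ?_ ?_
    · intro x y hxy
      refine ⟨?_, parity_iff.2 (by have := congrOn_iff.1 hxy; omega)⟩
      have key : ∀ x y : Fin m, x.val = 0 → y.val = 2 →
          (pair m 0 1 ⊔ _root_.edges m 1) x y := fun x y hx hy =>
        Setoid.trans' _ (y := ⟨1, by omega⟩)
          (sup_inl (pair_iff.2 (by simp [hx]))) (sup_inr (edges_iff.2 (by simp [hy])))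
      have hxy := congrOn_iff.1 hxy
      by_cases h₀ : x.val = y.val
      · exact sup_inl (pair_iff.2 (Or.inl h₀))
      · by_cases h₁ : x.val = 0
        · exact key x y h₁ (by omega)
        · exact Setoid.symm' _ (key y x (by omega) (by omega))
    · have hW : pair m' 0 1 ⊔ _root_.edges m' 1 ≤
          Setoid.ker fun x : Fin m' => if x.val ≤ 2 then 0 else (x.val + 1) / 2 := by
        refine sup_le (fun {x y} h => ?_) (fun {x y} h => ?_)
        · have := pair_iff.1 h
          rw [Setoid.ker_def]
          split_ifs <;> omega
        · have := edges_iff.1 h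
          rw [Setoid.ker_def]
          split_ifs <;> omega
      rintro x y ⟨h₁, h₂⟩
      have h₁ := Setoid.ker_def.1 (hW h₁)
      have h₂ := parity_iff.1 h₂
      refine congrOn_iff.2 ?_
      split_ifs at h₁ <;> omega
  | succ k hk ih =>
    exact h.mono (h.sup ih (h.inf (h.sup ih (h.edges k)) h.parity))
      (congrOn_zero_succ_le hk) le_congrOn_zero_succ

theorem final (h : SameRoles m c s m' c' s' P) {j : ℕ} (hj : j + 1 ≤ c) :
    P (congrOn m 2 (c - 1 - j) (c + 1)) (congrOn m' 2 (c' - 1 - j) m') := by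
  have hc := h.seven_le
  have hc' := h.seven_le'
  have hco := h.odd
  have hco' := h.odd'
  have hm := h.lt_size
  have hm' := h.lt_size'
  induction j with
  | zero =>
    refine h.mono (h.inf (h.sup h.pair_last h.edges₀) h.parity) ?_ ?_
    · intro x y hxy
      refine ⟨?_, parity_iff.2 (by have := congrOn_iff.1 hxy; omega)⟩
      have key : ∀ x y : Fin m, x.val = c - 1 → y.val = c + 1 →
          (pair m c (c + 1) ⊔ _root_.edges m 0) x y := fun x y hx hy =>
        Setoid.trans' _ (y := ⟨c, by omega⟩)
          (sup_inr (edges_iff.2 (by dsimp only; omega)))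
          (sup_inl (pair_iff.2 (by dsimp only; omega)))
      have hxy := congrOn_iff.1 hxy
      by_cases h₀ : x.val = y.val
      · exact sup_inl (pair_iff.2 (Or.inl h₀))
      · by_cases h₁ : x.val = c - 1
        · exact key x y h₁ (by omega)
        · exact Setoid.symm' _ (key y x (by omega) (by omega))
    · have hW : pair m' c' (c' + 1) ⊔ _root_.edges m' 0 ≤
          Setoid.ker fun x : Fin m' => if c' - 1 ≤ x.val then m' else x.val / 2 := by
        refine sup_le (fun {x y} h => ?_) (fun {x y} h => ?_)
        · have := pair_iff.1 h
          rw [Setoid.ker_def]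
          split_ifs <;> omega
        · have := edges_iff.1 h
          rw [Setoid.ker_def]
          split_ifs <;> omega
      rintro x y ⟨h₁, h₂⟩
      have h₁ := Setoid.ker_def.1 (hW h₁)
      have h₂ := parity_iff.1 h₂
      refine congrOn_iff.2 ?_
      split_ifs at h₁ <;> omega
  | succ j ih =>
    have ih := ih (by omega)
    rw [show c - 1 - j = c - 1 - (j + 1) + 1 by omega] at ih
    by_cases hj' : j + 2 ≤ c'
    · rw [show c' - 1 - j = c' - 1 - (j + 1) + 1 by omega] at ih
      have hE := h.edges (c - 1 - (j + 1))
      refine h.mono (h.sup ih (h.inf (h.sup ih hE) h.parity))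
        (congrOn_le_congrOn_succ (by omega) (by omega)) ?_
      rw [show (c - 1 - (j + 1)) % 2 = (c' - 1 - (j + 1)) % 2 by omega]
      exact congrOn_succ_le_congrOn
    · refine h.mono h.parity (fun {x y} hxy => parity_iff.2 ?_) (fun {x y} hxy => ?_)
      · have := congrOn_iff.1 hxy
        omega
      · have := parity_iff.1 hxy
        exact congrOn_iff.2 (by omega)

/-- A shorter path is separated from a longer one by the distance of the two marked edges. -/
theorem top_bot_of_lt (h : SameRoles m c s m' c' s' P) (hcc : c < c') : P ⊤ ⊥ := by
  have hc := h.seven_le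
  have hm := h.lt_size
  have hco := h.odd
  have hco' := h.odd'
  have key := h.inf (h.initial (k := c + 1) (by omega)) (h.final (j := 0) (by omega))
  refine h.disjointRoles.top_bot (x := c - 1) (by omega) (h.mono key ?_ ?_)
  · exact pair_le fun _ _ => ⟨congrOn_iff.2 (by dsimp only; omega),
      congrOn_iff.2 (by dsimp only; omega)⟩
  · refine setoid_le_bot fun x y ⟨h₁, h₂⟩ => Fin.ext ?_
    have h₁ := congrOn_iff.1 h₁
    have h₂ := congrOn_iff.1 h₂
    omega

/-- Two paths are separated by the distance of the marked pair from the first edge. -/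
theorem top_bot_of_mark_lt (h : SameRoles m c s m' c' s' P) (hss : s < s') : P ⊤ ⊥ := by
  have hc := h.seven_le
  have hc' := h.seven_le'
  have hm := h.lt_size
  have hs := h.mark_le
  have hs' := h.mark_le'
  have hmark : P (pair m s (s + 4)) ⊥ := by
    refine h.mono (h.inf (h.initial (k := s + 4) (by omega)) h.pair_mark) ?_ ?_
    · refine le_inf (pair_le fun _ _ => ?_) le_rfl
      exact congrOn_iff.2 (by dsimp only; omega)
    · refine setoid_le_bot fun x y ⟨h₁, h₂⟩ => Fin.ext ?_
      have h₁ := congrOn_iff.1 h₁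
      have h₂ := pair_iff.1 h₂
      omega
  have hmod := h.disjointRoles.congrOn_bot four_pos rfl (by omega) hmark m
  have key := h.inf (h.sup hmod (h.initial (k := 3) (by omega))) (h.final (j := 0) (by omega))
  refine h.disjointRoles.top_bot (x := c - 1) (by omega) (h.mono key ?_ ?_)
  · refine pair_le fun _ _ => ⟨?_, congrOn_iff.2 (by dsimp only; omega)⟩
    have hres : ∀ x : Fin m, congrOn m 4 0 m x ⟨x.val % 4, by omega⟩ := fun x =>
      congrOn_iff.2 (by dsimp only; omega)
    refine Setoid.trans' _ (sup_inl (hres _)) (Setoid.trans' _ (sup_inr ?_)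
      (Setoid.symm' _ (sup_inl (hres _))))
    exact congrOn_iff.2 (by dsimp only; omega)
  · rw [bot_sup_eq]
    refine setoid_le_bot fun x y ⟨h₁, h₂⟩ => Fin.ext ?_
    have h₁ := congrOn_iff.1 h₁
    have h₂ := congrOn_iff.1 h₂
    omega

end SameRoles

/-- Two paths in which the parity partition and the even edge partition are interchanged are
separated. -/
theorem top_bot_of_swap {m c s m' c' s' : ℕ} {P : Setoid (Fin m) → Setoid (Fin m') → Prop}
    (h : Approx P) (hα : P (parity m) (edges m' 0)) (hβ : P (edges m 0) (parity m'))
    (hγ : P (edges m 1) (edges m' 1)) (hδ : P (marks m c s) (marks m' c' s')) (hc : 7 ≤ c)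
    (hm : c + 1 < m) (hco' : c' % 2 = 1) (hs' : s' + 4 ≤ c') : P ⊤ ⊥ := by
  have hD : DisjointRoles m P (edges m' 0) (parity m') (edges m' 1) :=
    { toApprox := h
      parity := hα
      edges₀ := hβ
      edges₁ := hγ
      disj₀ := by rw [inf_comm, parity_inf_edges]
      disj₁ := edges_inf_edges m'
      disj := parity_inf_edges m' 1 }
  refine hD.top_bot (x := 0) (by omega) (h.mono (h.inf (h.sup (h.inf hβ hδ) hγ) hα) ?_ ?_)
  · refine pair_le fun _ _ => ⟨?_, parity_iff.2 (by simp)⟩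
    exact Setoid.trans' _ (y := ⟨1, by omega⟩)
      (sup_inl (pair_zero_one_le (pair_iff.2 (by simp)))) (sup_inr (edges_iff.2 (by simp)))
  · have hW : parity m' ⊓ marks m' c' s' ⊔ edges m' 1 ≤ Setoid.ker fun x : Fin m' =>
        if (x.val + 1) / 2 = (s' + 5) / 2 then (s' + 1) / 2 else (x.val + 1) / 2 := by
      refine sup_le ((parity_inf_marks_le hco' hs').trans fun {x y} h => ?_)
        (fun {x y} h => ?_)
      · have := pair_iff.1 h
        rw [Setoid.ker_def]
        split_ifs <;> omega
      · have := edges_iff.1 h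
        rw [Setoid.ker_def]
        split_ifs <;> omega
    refine setoid_le_bot fun x y ⟨h₁, h₂⟩ => Fin.ext ?_
    have h₁ := Setoid.ker_def.1 (hW h₁)
    have h₂ := edges_iff.1 h₂
    split_ifs at h₁ <;> omega

section Generation

variable {m : ℕ} {P : Setoid (Fin m) → Setoid (Fin m) → Prop}

theorem pair_comm (m i j : ℕ) : pair m i j = pair m j i :=
  Setoid.ext fun x y => by rw [pair_iff, pair_iff]; omega

theorem pair_le_triple {i j k i' j' : ℕ} (hi : i' = i ∨ i' = j ∨ i' = k)
    (hj : j' = i ∨ j' = j ∨ j' = k) : pair m i' j' ≤ triple m i j k := by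
  intro x y hxy
  have := pair_iff.1 hxy
  exact triple_iff.2 (by omega)

/-- Approximation of a pair by two paths of length two. -/
theorem Approx.pair_of_paths (h : Approx P) {i j k l : ℕ} (hk : k < m) (hl : l < m)
    (hkl : k ≠ l) (hik : P (pair m i k) (pair m i k)) (hkj : P (pair m k j) (pair m k j))
    (hil : P (pair m i l) (pair m i l)) (hlj : P (pair m l j) (pair m l j)) :
    P (pair m i j) (pair m i j) := by
  refine h.mono (h.inf (h.sup hik hkj) (h.sup hil hlj)) ?_ ?_
  · refine pair_le fun hi hj => ⟨?_, ?_⟩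
    · exact Setoid.trans' _ (y := ⟨k, hk⟩) (sup_inl (pair_iff.2 (by simp)))
        (sup_inr (pair_iff.2 (by simp)))
    · exact Setoid.trans' _ (y := ⟨l, hl⟩) (sup_inl (pair_iff.2 (by simp)))
        (sup_inr (pair_iff.2 (by simp)))
  · have h₁ : pair m i k ⊔ pair m k j ≤ triple m i k j :=
      sup_le (pair_le_triple (by simp) (by simp)) (pair_le_triple (by simp) (by simp))
    have h₂ : pair m i l ⊔ pair m l j ≤ triple m i l j :=
      sup_le (pair_le_triple (by simp) (by simp)) (pair_le_triple (by simp) (by simp))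
    refine (inf_le_inf h₁ h₂).trans ?_
    rintro x y ⟨hx, hy⟩
    have hx := triple_iff.1 hx
    have hy := triple_iff.1 hy
    exact pair_iff.2 (by omega)

theorem Approx.refl_of_pairs (h : Approx P) (h_bot : P ⊥ ⊥)
    (hpair : ∀ i j, i < j → j < m → P (pair m i j) (pair m i j)) (θ : Setoid (Fin m)) :
    P θ θ := by
  classical
  have hpair' : ∀ i j : Fin m, P (pair m i j) (pair m i j) := by
    intro i j
    rcases lt_trichotomy i.val j.val with hij | hij | hij
    · exact hpair _ _ hij j.isLt
    · refine h.mono h_bot (setoid_le_bot fun x y hxy => Fin.ext ?_) bot_le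
      have := pair_iff.1 hxy
      omega
    · rw [pair_comm]
      exact hpair _ _ hij i.isLt
  have hsup : ∀ F : Finset (Fin m × Fin m),
      P (F.sup fun p => pair m p.1 p.2) (F.sup fun p => pair m p.1 p.2) := by
    intro F
    induction F using Finset.induction_on with
    | empty => simpa using h_bot
    | insert p F _ ih => simpa using h.sup (hpair' p.1 p.2) ih
  refine h.mono (hsup (Finset.univ.filter fun p : Fin m × Fin m => θ p.1 p.2)) ?_ ?_
  · intro x y hxy
    have hle : pair m x y ≤ (Finset.univ.filter fun p : Fin m × Fin m => θ p.1 p.2).sup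
        fun p => pair m p.1 p.2 :=
      Finset.le_sup (f := fun p : Fin m × Fin m => pair m p.1 p.2) (b := (x, y))
        (by simpa using hxy)
    exact hle (pair_iff.2 (by simp))
  · exact Finset.sup_le fun p hp => pair_le fun _ _ => (Finset.mem_filter.1 hp).2

namespace SameRoles

variable {c s : ℕ}

theorem bot_bot (h : SameRoles m c s m c s P) : P ⊥ ⊥ :=
  h.disjointRoles.bot

theorem pair_add_two (h : SameRoles m c s m c s P) {i : ℕ} (hi : i < c) :
    P (pair m i (i + 2)) (pair m i (i + 2)) := by
  have hm := h.lt_size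
  have key := h.inf (h.initial (k := i + 2) (by omega)) (h.final (j := c - 1 - i) (by omega))
  rw [show c - 1 - (c - 1 - i) = i by omega] at key
  refine h.mono key ?_ ?_
  · exact pair_le fun _ _ => ⟨congrOn_iff.2 (by dsimp only; omega),
      congrOn_iff.2 (by dsimp only; omega)⟩
  · rintro x y ⟨h₁, h₂⟩
    have h₁ := congrOn_iff.1 h₁
    have h₂ := congrOn_iff.1 h₂
    exact pair_iff.2 (by omega)

theorem pair_of_lt (h : SameRoles m c s m c s P) {M : ℕ} (hM : M ≤ m)
    (h₂ : ∀ i, i + 2 < M → P (pair m i (i + 2)) (pair m i (i + 2))) {i j : ℕ} (hij : i < j)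
    (hj : j < M) : P (pair m i j) (pair m i j) := by
  have h₁ : ∀ i, i + 1 < M → P (pair m i (i + 1)) (pair m i (i + 1)) := by
    intro i
    induction i with
    | zero => exact fun _ => h.pair_zero_one
    | succ i ih =>
      intro hi
      refine h.mono (h.inf (h.sup (ih (by omega)) (h₂ i (by omega))) (h.edges (i + 1))) ?_ ?_
      · refine pair_le fun _ _ => ⟨?_, edges_iff.2 (by dsimp only; omega)⟩
        exact Setoid.trans' _ (y := ⟨i, by omega⟩) (sup_inl (pair_iff.2 (by simp)))
          (sup_inr (pair_iff.2 (by simp)))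
      · have hW : pair m i (i + 1) ⊔ pair m i (i + 2) ≤ triple m i (i + 1) (i + 2) :=
          sup_le (pair_le_triple (by simp) (by simp)) (pair_le_triple (by simp) (by simp))
        rintro x y ⟨hx, hy⟩
        have hx := triple_iff.1 (hW hx)
        have hy := edges_iff.1 hy
        exact pair_iff.2 (by omega)
  obtain ⟨d, rfl⟩ : ∃ d, j = i + (d + 1) := ⟨j - i - 1, by omega⟩
  induction d using Nat.strong_induction_on generalizing i with
  | _ d ih =>
    match d with
    | 0 => exact h₁ i hj
    | 1 => exact h₂ i hj
    | d + 2 =>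
      have e₁ := ih (d + 1) (by omega) (i := i + 1) (by omega) (by omega)
      have e₂ := ih d (by omega) (i := i + 2) (by omega) (by omega)
      rw [show i + 1 + (d + 1 + 1) = i + (d + 2 + 1) by omega] at e₁
      rw [show i + 2 + (d + 1) = i + (d + 2 + 1) by omega] at e₂
      exact h.pair_of_paths (k := i + 1) (l := i + 2) (by omega) (by omega) (by omega)
        (h₁ i (by omega)) e₁ (h₂ i (by omega)) e₂

/-- If the path has one more point after the last marked edge, then this point is joined to its
second neighbour. -/
theorem pair_beyond (h : SameRoles m c s m c s P) (hm : m = c + 3) :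
    P (pair m c (c + 2)) (pair m c (c + 2)) := by
  have hc := h.seven_le
  have hco := h.odd
  have hlow : ∀ {i j : ℕ}, i < j → j < c + 2 → P (pair m i j) (pair m i j) := fun hij hj =>
    h.pair_of_lt (by omega) (fun i hi => h.pair_add_two (by omega)) hij hj
  have hW : ∀ x, x % 2 = 1 → x ≤ c → pair m x (c + 1) ⊔ _root_.edges m 0 ≤
      Setoid.ker fun z : Fin m => if z.val / 2 = x / 2 then (c + 1) / 2 else z.val / 2 := by
    intro x hx hxc
    refine sup_le (fun {y z} h => ?_) (fun {y z} h => ?_)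
    · have := pair_iff.1 h
      rw [Setoid.ker_def]
      split_ifs <;> omega
    · have := edges_iff.1 h
      rw [Setoid.ker_def]
      split_ifs <;> omega
  have hA : ∀ x, x % 2 = 1 → x ≤ c →
      P (pair m x (c + 2)) (pair m x (c + 2) ⊔ pair m (x - 1) (c + 1)) := by
    intro x hx hxc
    refine h.mono (h.inf (h.sup (hlow (i := x) (j := c + 1) (by omega) (by omega)) h.edges₀)
      h.parity) ?_ ?_
    · refine pair_le fun _ _ => ⟨?_, parity_iff.2 (by dsimp only; omega)⟩
      exact Setoid.trans' _ (y := ⟨c + 1, by omega⟩) (sup_inl (pair_iff.2 (by simp)))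
        (sup_inr (edges_iff.2 (by dsimp only; omega)))
    · rintro y z ⟨h₁, h₂⟩
      have h₁ := Setoid.ker_def.1 (hW x hx hxc h₁)
      have h₂ := parity_iff.1 h₂
      have := y.isLt
      have := z.isLt
      by_cases hy : y.val % 2 = 1
      · refine sup_inl (pair_iff.2 ?_)
        split_ifs at h₁ <;> omega
      · refine sup_inr (pair_iff.2 ?_)
        split_ifs at h₁ <;> omega
  refine h.mono (h.inf (hA c hco le_rfl)
    (h.sup (hA (c - 2) (by omega) (by omega))
      (hlow (i := c - 2) (j := c) (by omega) (by omega)))) ?_ ?_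
  · refine le_inf le_rfl (pair_le fun _ _ => ?_)
    exact Setoid.trans' _ (y := ⟨c - 2, by omega⟩) (sup_inr (pair_iff.2 (by simp)))
      (sup_inl (pair_iff.2 (by simp)))
  · have h₁ : pair m c (c + 2) ⊔ pair m (c - 1) (c + 1) ≤ Setoid.ker fun z : Fin m =>
        if z.val = c + 2 then c else if z.val = c + 1 then c - 1 else z.val := by
      refine sup_le (fun {y z} h => ?_) (fun {y z} h => ?_) <;>
      · have := pair_iff.1 h
        rw [Setoid.ker_def]
        split_ifs <;> omega
    have h₂ : pair m (c - 2) (c + 2) ⊔ pair m (c - 2 - 1) (c + 1) ⊔ pair m (c - 2) c ≤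
        Setoid.ker fun z : Fin m => if z.val = c + 2 ∨ z.val = c then c - 2 else
          if z.val = c + 1 then c - 3 else z.val := by
      refine sup_le (sup_le (fun {y z} h => ?_) (fun {y z} h => ?_)) (fun {y z} h => ?_) <;>
      · have := pair_iff.1 h
        rw [Setoid.ker_def]
        split_ifs <;> omega
    rintro y z ⟨hy, hz⟩
    have hy := Setoid.ker_def.1 (h₁ hy)
    have hz := Setoid.ker_def.1 (h₂ hz)
    refine pair_iff.2 ?_
    split_ifs at hy hz <;> omega

/-- The four partitions generate the whole partition lattice. -/
theorem refl (h : SameRoles m c s m c s P) (hm : m ≤ c + 3) (θ : Setoid (Fin m)) : P θ θ := by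
  have hc := h.lt_size
  refine h.refl_of_pairs h.bot_bot (fun i j hij hj => ?_) θ
  refine h.pair_of_lt le_rfl (fun i hi => ?_) hij hj
  by_cases hi' : i < c
  · exact h.pair_add_two hi'
  · obtain rfl : i = c := by omega
    exact h.pair_beyond (by omega)

end SameRoles

end Generation

/-- A sublattice of a finite product of bounded lattices is the whole product if it projects onto
every factor and separates any two factors. -/
theorem IsSublattice.eq_univ_of_separates {ι : Type*} [Fintype ι] [Nonempty ι] {L : ι → Type*}
    [∀ i, Lattice (L i)] [∀ i, BoundedOrder (L i)] {S : Set (∀ i, L i)} (hS : IsSublattice S)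
    (hsurj : ∀ i (x : L i), ∃ z ∈ S, z i = x)
    (hsep : ∀ i j, i ≠ j → ∃ z ∈ S, z i = ⊤ ∧ z j = ⊥) : S = Set.univ := by
  classical
  have hcoord : ∀ i, ∃ z ∈ S, z i = ⊤ ∧ ∀ j, j ≠ i → z j = ⊥ := by
    intro i
    have : ∀ j, ∃ z ∈ S, z i = ⊤ ∧ (j ≠ i → z j = ⊥) := by
      intro j
      by_cases hj : j = i
      · obtain ⟨z, hz, hzi⟩ := hsurj i ⊤
        exact ⟨z, hz, hzi, fun h => absurd hj h⟩
      · obtain ⟨z, hz, hzi, hzj⟩ := hsep i j (Ne.symm hj)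
        exact ⟨z, hz, hzi, fun _ => hzj⟩
    choose z hz hzi hzj using this
    refine ⟨Finset.univ.inf' Finset.univ_nonempty z,
      hS.infClosed.finsetInf'_mem Finset.univ_nonempty fun j _ => hz j, ?_, fun j hj => ?_⟩
    · rw [Finset.inf'_apply]
      exact top_le_iff.1 (Finset.le_inf' _ _ fun j _ => (hzi j).ge)
    · rw [Finset.inf'_apply]
      exact le_bot_iff.1 ((Finset.inf'_le _ (Finset.mem_univ j)).trans (hzj j hj).le)
  refine Set.eq_univ_of_forall fun x => ?_
  have : ∀ i, ∃ z ∈ S, z i = x i ∧ ∀ j, j ≠ i → z j = ⊥ := by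
    intro i
    obtain ⟨e, he, hei, hej⟩ := hcoord i
    obtain ⟨z, hz, hzi⟩ := hsurj i (x i)
    refine ⟨e ⊓ z, hS.infClosed he hz, by simp [hei, hzi], fun j hj => by simp [hej j hj]⟩
  choose z hz hzi hzj using this
  have hx : x = Finset.univ.sup' Finset.univ_nonempty z := by
    funext i
    rw [Finset.sup'_apply]
    refine le_antisymm ?_ (Finset.sup'_le _ _ fun j _ => ?_)
    · exact (hzi i).ge.trans (Finset.le_sup' (fun j => z j i) (Finset.mem_univ i))
    · by_cases hij : i = j
      · subst hij
        exact (hzi i).le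
      · simp [hzj j i hij]
  rw [hx]
  exact hS.supClosed.finsetSup'_mem Finset.univ_nonempty fun j _ => hz j

theorem approx_of_isSublattice {ι : Type*} {L : ι → Type*} [∀ i, Lattice (L i)]
    {S : Set (∀ i, L i)} (hS : IsSublattice S) (i j : ι) :
    Approx fun (x : L i) (y : L j) => ∃ z ∈ S, x ≤ z i ∧ z j ≤ y where
  sup := by
    rintro _ _ _ _ ⟨z, hz, h₁, h₂⟩ ⟨z', hz', h₁', h₂'⟩
    exact ⟨z ⊔ z', hS.supClosed hz hz', sup_le_sup h₁ h₁', sup_le_sup h₂ h₂'⟩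
  inf := by
    rintro _ _ _ _ ⟨z, hz, h₁, h₂⟩ ⟨z', hz', h₁', h₂'⟩
    exact ⟨z ⊓ z', hS.infClosed hz hz', inf_le_inf h₁ h₁', inf_le_inf h₂ h₂'⟩
  mono := by
    rintro _ _ _ _ ⟨z, hz, h₁, h₂⟩ h h'
    exact ⟨z, hz, h.trans h₁, h₂.trans h'⟩

/-- The left end of the last marked edge on the path with `m` points. -/
def lastMark (m : ℕ) : ℕ := 2 * ((m - 1) / 2) - 1

theorem lastMark_spec {m : ℕ} (hm : 9 ≤ m) :
    lastMark m % 2 = 1 ∧ 7 ≤ lastMark m ∧ lastMark m + 1 < m ∧ m ≤ lastMark m + 3 := by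
  unfold lastMark
  omega

/-- The left end of the marked pair on the path with `m` points, for the product of partition
lattices starting with the one on `n` points. -/
def midMark (n m : ℕ) : ℕ := n - 7 - (m - n) / 2

/-- The parity partition if `m + r` is odd, and the even edge partition otherwise. -/
def alternating (r m : ℕ) : Setoid (Fin m) := if (m + r) % 2 = 1 then parity m else edges m 0

theorem parity_ne_edges {m : ℕ} (hm : 3 ≤ m) (ε : ℕ) : parity m ≠ edges m ε := fun h => by
  have h₁ : parity m ⟨0, by omega⟩ ⟨2, by omega⟩ := parity_iff.2 (by simp)
  rw [h] at h₁
  have := edges_iff.1 h₁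
  dsimp only at this
  omega

theorem edges_zero_ne_edges_one {m : ℕ} (hm : 2 ≤ m) : edges m 0 ≠ edges m 1 := fun h => by
  have h₁ : edges m 0 ⟨0, by omega⟩ ⟨1, by omega⟩ := edges_iff.2 (by simp)
  rw [h] at h₁
  simpa using edges_iff.1 h₁

theorem marks_zero_one {m c s : ℕ} (hm : 2 ≤ m) :
    marks m c s ⟨0, by omega⟩ ⟨1, by omega⟩ :=
  (pair_zero_one_le (pair_iff.2 (by simp))).2

theorem parity_ne_marks {m c s : ℕ} (hm : 2 ≤ m) : parity m ≠ marks m c s := fun h => by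
  have h₁ := marks_zero_one (c := c) (s := s) hm
  rw [← h] at h₁
  simpa using parity_iff.1 h₁

theorem edges_one_ne_marks {m c s : ℕ} (hm : 2 ≤ m) : edges m 1 ≠ marks m c s := fun h => by
  have h₁ := marks_zero_one (c := c) (s := s) hm
  rw [← h] at h₁
  simpa using edges_iff.1 h₁

theorem edges_zero_ne_marks {m c s : ℕ} (hc : 7 ≤ c) (hco : c % 2 = 1) (hm : c + 1 < m) :
    edges m 0 ≠ marks m c s := fun h => by
  have h₁ : marks m c s ⟨c, by omega⟩ ⟨c + 1, hm⟩ :=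
    (pair_last_le hc hco (pair_iff.2 (by simp))).2
  rw [← h] at h₁
  have := edges_iff.1 h₁
  dsimp only at this
  omega

/-- For every integer `n ≥ 9`, the direct product
`Part(n) × Part(n+1) × … × Part(3n - 14)` of partition lattices (there are `2n - 13`
factors, the `i`-th being `Setoid (Fin (n + i))`), with componentwise meets and joins,
is four-generated. -/
theorem part_consecutive_prod_fourGenerated (n : ℕ) (hn : 9 ≤ n) :
    FourGenerated (∀ i : Fin (2 * n - 13), Setoid (Fin (n + i.val))) := by
  classical
  let g₁ : ∀ i : Fin (2 * n - 13), Setoid (Fin (n + i.val)) := fun i => alternating 0 (n + i)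
  let g₂ : ∀ i : Fin (2 * n - 13), Setoid (Fin (n + i.val)) := fun i => alternating 1 (n + i)
  let g₃ : ∀ i : Fin (2 * n - 13), Setoid (Fin (n + i.val)) := fun i => edges (n + i) 1
  let g₄ : ∀ i : Fin (2 * n - 13), Setoid (Fin (n + i.val)) := fun i =>
    marks (n + i) (lastMark (n + i)) (midMark n (n + i))
  have i₀ : Fin (2 * n - 13) := ⟨0, by omega⟩
  have : Nonempty (Fin (2 * n - 13)) := ⟨i₀⟩
  refine ⟨{g₁, g₂, g₃, g₄}, ?_, ?_⟩
  · have hodd := (lastMark_spec (m := n + i₀) (by omega)).1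
    have hlt := (lastMark_spec (m := n + i₀) (by omega)).2.2.1
    have hle := (lastMark_spec (m := n + i₀) (by omega)).2.1
    have h₁₂ : g₁ ≠ g₂ := fun h => by
      have h' : alternating 0 (n + i₀) = alternating 1 (n + i₀) := congrFun h i₀
      unfold alternating at h'
      split_ifs at h' <;> first | omega | skip
      exacts [parity_ne_edges (by omega) 0 h', parity_ne_edges (by omega) 0 h'.symm]
    have h₃ : ∀ r, alternating r (n + i₀) ≠ edges (n + i₀) 1 := fun r => by
      unfold alternating
      split_ifs
      exacts [parity_ne_edges (by omega) 1, edges_zero_ne_edges_one (by omega)]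
    have h₄ : ∀ r, alternating r (n + i₀) ≠ g₄ i₀ := fun r => by
      unfold alternating
      split_ifs
      exacts [parity_ne_marks (by omega), edges_zero_ne_marks hle hodd hlt]
    have h₁₃ : g₁ ≠ g₃ := fun h => h₃ 0 (congrFun h i₀)
    have h₂₃ : g₂ ≠ g₃ := fun h => h₃ 1 (congrFun h i₀)
    have h₁₄ : g₁ ≠ g₄ := fun h => h₄ 0 (congrFun h i₀)
    have h₂₄ : g₂ ≠ g₄ := fun h => h₄ 1 (congrFun h i₀)
    have h₃₄ : g₃ ≠ g₄ := fun h => edges_one_ne_marks (by omega) (congrFun h i₀)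
    rw [Finset.card_insert_of_notMem (by simp [h₁₂, h₁₃, h₁₄]),
      Finset.card_insert_of_notMem (by simp [h₂₃, h₂₄]), Finset.card_pair h₃₄]
  set S : Set (∀ i : Fin (2 * n - 13), Setoid (Fin (n + i.val))) :=
    latticeClosure (({g₁, g₂, g₃, g₄} : Finset _) : Set _)
  have hS : IsSublattice S := isSublattice_latticeClosure
  have hsub : (({g₁, g₂, g₃, g₄} : Finset _) : Set _) ⊆ S := subset_latticeClosure
  have hg₁ : g₁ ∈ S := hsub (by simp)
  have hg₂ : g₂ ∈ S := hsub (by simp)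
  have hg₃ : g₃ ∈ S := hsub (by simp)
  have hg₄ : g₄ ∈ S := hsub (by simp)
  have hlast := fun i : Fin (2 * n - 13) => lastMark_spec (m := n + i) (by omega)
  have hgen : ∀ {g : ∀ i : Fin (2 * n - 13), Setoid (Fin (n + i.val))}, g ∈ S →
      ∀ i j, ∃ z ∈ S, g i ≤ z i ∧ z j ≤ g j := fun {g} hg i j => ⟨g, hg, le_rfl, le_rfl⟩
  have hodd : ∀ i : Fin (2 * n - 13), (n + i.val) % 2 = 1 →
      g₁ i = parity (n + i) ∧ g₂ i = edges (n + i) 0 := fun i hi =>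
    ⟨if_pos (by omega), if_neg (by omega)⟩
  have heven : ∀ i : Fin (2 * n - 13), (n + i.val) % 2 = 0 →
      g₁ i = edges (n + i) 0 ∧ g₂ i = parity (n + i) := fun i hi =>
    ⟨if_neg (by omega), if_pos (by omega)⟩
  have hsame : ∀ i j : Fin (2 * n - 13), (n + i.val) % 2 = (n + j.val) % 2 →
      SameRoles (n + i) (lastMark (n + i)) (midMark n (n + i)) (n + j) (lastMark (n + j))
        (midMark n (n + j)) fun x y => ∃ z ∈ S, x ≤ z i ∧ z j ≤ y := by
    intro i j hij
    have hpe : (∃ z ∈ S, parity (n + i) ≤ z i ∧ z j ≤ parity (n + j)) ∧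
        (∃ z ∈ S, edges (n + i) 0 ≤ z i ∧ z j ≤ edges (n + j) 0) := by
      rcases Nat.mod_two_eq_zero_or_one (n + i.val) with hi | hi
      · obtain ⟨h₁, h₂⟩ := heven i hi
        obtain ⟨h₃, h₄⟩ := heven j (by omega)
        rw [← h₁, ← h₂, ← h₃, ← h₄]
        exact ⟨hgen hg₂ i j, hgen hg₁ i j⟩
      · obtain ⟨h₁, h₂⟩ := hodd i hi
        obtain ⟨h₃, h₄⟩ := hodd j (by omega)
        rw [← h₁, ← h₂, ← h₃, ← h₄]
        exact ⟨hgen hg₁ i j, hgen hg₂ i j⟩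
    exact
      { toApprox := approx_of_isSublattice hS i j
        parity := hpe.1
        edges₀ := hpe.2
        edges₁ := hgen hg₃ i j
        marks := hgen hg₄ i j
        seven_le := (hlast i).2.1
        odd := (hlast i).1
        lt_size := (hlast i).2.2.1
        mark_le := by unfold lastMark midMark; omega
        seven_le' := (hlast j).2.1
        odd' := (hlast j).1
        lt_size' := (hlast j).2.2.1
        mark_le' := by unfold lastMark midMark; omega }
  refine hS.eq_univ_of_separates (fun i x => ?_) (fun i j hij => ?_)
  · obtain ⟨z, hz, h₁, h₂⟩ := (hsame i i rfl).refl (hlast i).2.2.2 x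
    exact ⟨z, hz, le_antisymm h₂ h₁⟩
  · suffices h : ∃ z ∈ S, (⊤ : Setoid (Fin (n + i.val))) ≤ z i ∧ z j ≤ ⊥ by
      obtain ⟨z, hz, h₁, h₂⟩ := h
      exact ⟨z, hz, top_le_iff.1 h₁, le_bot_iff.1 h₂⟩
    have hij' : i.val ≠ j.val := fun h => hij (Fin.ext h)
    by_cases hpar : (n + i.val) % 2 = (n + j.val) % 2
    · rcases lt_or_gt_of_ne hij' with hlt | hlt
      · exact (hsame i j hpar).top_bot_of_lt (by unfold lastMark; omega)
      · exact (hsame i j hpar).top_bot_of_mark_lt (by unfold midMark; omega)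
    · have hpe : (∃ z ∈ S, parity (n + i) ≤ z i ∧ z j ≤ edges (n + j) 0) ∧
          (∃ z ∈ S, edges (n + i) 0 ≤ z i ∧ z j ≤ parity (n + j)) := by
        rcases Nat.mod_two_eq_zero_or_one (n + i.val) with hi | hi
        · obtain ⟨h₁, h₂⟩ := heven i hi
          obtain ⟨h₃, h₄⟩ := hodd j (by omega)
          rw [← h₁, ← h₂, ← h₃, ← h₄]
          exact ⟨hgen hg₂ i j, hgen hg₁ i j⟩
        · obtain ⟨h₁, h₂⟩ := hodd i hi
          obtain ⟨h₃, h₄⟩ := heven j (by omega)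
          rw [← h₁, ← h₂, ← h₃, ← h₄]
          exact ⟨hgen hg₁ i j, hgen hg₂ i j⟩
      exact top_bot_of_swap (approx_of_isSublattice hS i j) hpe.1 hpe.2 (hgen hg₃ i j)
        (hgen hg₄ i j) (hlast i).2.1 (hlast i).2.2.1 (hlast j).1
        (by unfold lastMark midMark; omega)
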